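/- There exists an absolute constant c > 0 such that for every integer n≥1, every real q with 1/2 ≤ q ≤ 1 − 4/n, and every integer L with n(1−q) ≤ L ≤ c·n·√(1−q), if π is distributed according to the (n,q)-Mallows measure, then P(LIS(π) < L) ≤ exp(−c(1−q)n²/L). -/

import Mathlib

open Finset

/-- Number of inversions of a permutation of `Fin n`. -/
def mallowsInv {n : ℕ} (π : Equiv.Perm (Fin n)) : ℕ :=
  (Finset.univ.filter (fun p : Fin n × Fin n => p.1 < p.2 ∧ π p.2 < π p.1)).card

/-- The `(n,q)`-Mallows probability mass function on `S_n`. -/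
noncomputable def mallowsPMF (n : ℕ) (q : ℝ) (π : Equiv.Perm (Fin n)) : ℝ :=
  q ^ mallowsInv π / ∑ σ : Equiv.Perm (Fin n), q ^ mallowsInv σ

/-- Probability of an event under the `(n,q)`-Mallows measure. -/
noncomputable def mallowsProb (n : ℕ) (q : ℝ) (A : Set (Equiv.Perm (Fin n))) : ℝ :=
  ∑ π : Equiv.Perm (Fin n), A.indicator (mallowsPMF n q) π

/-- Expectation of a function under the `(n,q)`-Mallows measure. -/
noncomputable def mallowsExp (n : ℕ) (q : ℝ) (f : Equiv.Perm (Fin n) → ℝ) : ℝ :=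
  ∑ π : Equiv.Perm (Fin n), mallowsPMF n q π * f π

/-- Length of the longest increasing subsequence of a permutation of `Fin n`. -/
noncomputable def LIS {n : ℕ} (π : Equiv.Perm (Fin n)) : ℕ :=
  sSup {m | ∃ f : Fin m → Fin n, StrictMono f ∧ StrictMono (fun j => π (f j))}

/-- Length of the longest decreasing subsequence of a permutation of `Fin n`. -/
noncomputable def LDS {n : ℕ} (π : Equiv.Perm (Fin n)) : ℕ :=
  sSup {m | ∃ f : Fin m → Fin n, StrictMono f ∧ StrictAnti (fun j => π (f j))}

/-- The permutation of `Fin (m + 1)` with first value `r` whose remaining values are in the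
relative order given by `σ`. -/
def Equiv.Perm.consPerm {m : ℕ} (r : Fin (m + 1)) (σ : Equiv.Perm (Fin m)) :
    Equiv.Perm (Fin (m + 1)) :=
  ((finSuccEquiv m).trans (Equiv.optionCongr σ)).trans (finSuccEquiv' r).symm

open Equiv.Perm (consPerm)

@[simp] lemma consPerm_zero {m : ℕ} (r : Fin (m + 1)) (σ : Equiv.Perm (Fin m)) :
    consPerm r σ 0 = r := by
  simp [consPerm]

@[simp] lemma consPerm_succ {m : ℕ} (r : Fin (m + 1)) (σ : Equiv.Perm (Fin m)) (i : Fin m) :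
    consPerm r σ i.succ = r.succAbove (σ i) := by
  simp [consPerm]

lemma consPerm_bijective (m : ℕ) :
    Function.Bijective (fun p : Fin (m + 1) × Equiv.Perm (Fin m) => consPerm p.1 p.2) := by
  rw [Fintype.bijective_iff_injective_and_card]
  constructor
  · rintro ⟨r, σ⟩ ⟨s, τ⟩ h
    have h' : ∀ i, consPerm r σ i = consPerm s τ i := fun i => DFunLike.congr_fun h i
    have hrs : r = s := by simpa using h' 0
    subst hrs
    have hst : σ = τ := by
      ext1 i
      simpa using h' i.succ
    rw [hst]
  · simp [Fintype.card_perm, Nat.factorial_succ]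

lemma sum_perm_succ {m : ℕ} (f : Equiv.Perm (Fin (m + 1)) → ℝ) :
    ∑ π, f π = ∑ r : Fin (m + 1), ∑ σ : Equiv.Perm (Fin m), f (consPerm r σ) := by
  rw [← Fintype.sum_prod_type']
  exact ((consPerm_bijective m).sum_comp f).symm

lemma mallowsInv_eq_sum {n : ℕ} (π : Equiv.Perm (Fin n)) :
    mallowsInv π = ∑ i, ∑ j, if i < j ∧ π j < π i then 1 else 0 := by
  rw [mallowsInv, Finset.card_filter, Fintype.sum_prod_type]

lemma sum_succAbove_lt {m : ℕ} (r : Fin (m + 1)) :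
    (∑ k : Fin m, if r.succAbove k < r then 1 else 0) = (r : ℕ) := by
  simp_rw [Fin.succAbove_lt_iff_castSucc_lt, Fin.lt_def, Fin.val_castSucc]
  rw [Fin.sum_univ_eq_sum_range (fun k => if k < (r : ℕ) then 1 else 0) m,
    ← Finset.card_filter]
  have : (Finset.range m).filter (· < (r : ℕ)) = Finset.range r := by
    ext k
    have := r.is_lt
    simp only [Finset.mem_filter, Finset.mem_range]
    omega
  rw [this, Finset.card_range]

lemma mallowsInv_consPerm {m : ℕ} (r : Fin (m + 1)) (σ : Equiv.Perm (Fin m)) :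
    mallowsInv (consPerm r σ) = r + mallowsInv σ := by
  simp only [mallowsInv_eq_sum, Fin.sum_univ_succ, consPerm_zero, consPerm_succ,
    false_and, if_false, Fin.succ_pos, true_and, Fin.succ_lt_succ_iff, Fin.not_lt_zero,
    (Fin.strictMono_succAbove r).lt_iff_lt, zero_add]
  rw [Equiv.sum_comp σ (fun k => if r.succAbove k < r then 1 else 0), sum_succAbove_lt]

/-- Length of the longest increasing subsequence of `π` using only values that are at least `R`. -/
noncomputable def lisAbove {n : ℕ} (π : Equiv.Perm (Fin n)) (R : ℕ) : ℕ :=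
  sSup {m | ∃ f : Fin m → Fin n,
    StrictMono f ∧ StrictMono (fun j => π (f j)) ∧ ∀ j, R ≤ (π (f j) : ℕ)}

lemma le_lisAbove {n m R : ℕ} {π : Equiv.Perm (Fin n)} (f : Fin m → Fin n) (hf : StrictMono f)
    (hπ : StrictMono (fun j => π (f j))) (hR : ∀ j, R ≤ (π (f j) : ℕ)) : m ≤ lisAbove π R := by
  refine le_csSup ⟨n, ?_⟩ ⟨f, hf, hπ, hR⟩
  rintro k ⟨g, hg, -⟩
  simpa using Fintype.card_le_of_injective g hg.injective

lemma exists_lisAbove {n : ℕ} (π : Equiv.Perm (Fin n)) (R : ℕ) :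
    ∃ f : Fin (lisAbove π R) → Fin n,
      StrictMono f ∧ StrictMono (fun j => π (f j)) ∧ ∀ j, R ≤ (π (f j) : ℕ) := by
  refine Nat.sSup_mem (s := {m | ∃ f : Fin m → Fin n,
    StrictMono f ∧ StrictMono (fun j => π (f j)) ∧ ∀ j, R ≤ (π (f j) : ℕ)})
    ⟨0, Fin.elim0, fun i => i.elim0, fun i => i.elim0, fun i => i.elim0⟩ ⟨n, ?_⟩
  rintro k ⟨g, hg, -⟩
  simpa using Fintype.card_le_of_injective g hg.injective

lemma lisAbove_zero {n : ℕ} (π : Equiv.Perm (Fin n)) : lisAbove π 0 = LIS π := by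
  simp [lisAbove, LIS]

lemma val_succAbove_eq {m : ℕ} (r : Fin (m + 1)) (k : Fin m) :
    (r.succAbove k : ℕ) = if (k : ℕ) < r then (k : ℕ) else k + 1 := by
  simp only [Fin.succAbove, Fin.lt_def, Fin.val_castSucc]
  split_ifs <;> simp

lemma lisAbove_le_consPerm {m R : ℕ} (r : Fin (m + 1)) (σ : Equiv.Perm (Fin m)) :
    lisAbove σ R ≤ lisAbove (consPerm r σ) R := by
  obtain ⟨f, hf, hσ, hR⟩ := exists_lisAbove σ R
  refine le_lisAbove (fun j => (f j).succ) (fun i j h => Fin.succ_lt_succ_iff.2 (hf h)) ?_ ?_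
  · intro i j h
    simpa [(Fin.strictMono_succAbove r).lt_iff_lt] using hσ h
  · intro j
    have := hR j
    rw [consPerm_succ, val_succAbove_eq]
    split_ifs <;> omega

lemma lisAbove_pred_le_consPerm {m R : ℕ} (r : Fin (m + 1)) (σ : Equiv.Perm (Fin m))
    (h : (r : ℕ) < R) : lisAbove σ (R - 1) ≤ lisAbove (consPerm r σ) R := by
  obtain ⟨f, hf, hσ, hR⟩ := exists_lisAbove σ (R - 1)
  refine le_lisAbove (fun j => (f j).succ) (fun i j h => Fin.succ_lt_succ_iff.2 (hf h)) ?_ ?_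
  · intro i j h
    simpa [(Fin.strictMono_succAbove r).lt_iff_lt] using hσ h
  · intro j
    have := hR j
    rw [consPerm_succ, val_succAbove_eq]
    split_ifs <;> omega

lemma lisAbove_add_one_le_consPerm {m R : ℕ} (r : Fin (m + 1)) (σ : Equiv.Perm (Fin m))
    (h : R ≤ (r : ℕ)) : lisAbove σ r + 1 ≤ lisAbove (consPerm r σ) R := by
  obtain ⟨f, hf, hσ, hR⟩ := exists_lisAbove σ r
  refine le_lisAbove (Fin.cons 0 (fun j => (f j).succ)) ?_ ?_ ?_
  · intro i j
    refine Fin.cases ?_ (fun i => ?_) i <;> refine Fin.cases ?_ (fun j => ?_) j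
    · simp
    · simp
    · simp
    · simpa using fun h => hf h
  · intro i j
    refine Fin.cases ?_ (fun i => ?_) i <;> refine Fin.cases ?_ (fun j => ?_) j
    · simp
    · intro _
      have := hR j
      simp only [Fin.cons_zero, Fin.cons_succ, consPerm_zero, consPerm_succ]
      rw [Fin.lt_def, val_succAbove_eq]
      split_ifs <;> omega
    · simp
    · simpa [(Fin.strictMono_succAbove r).lt_iff_lt] using fun h => hσ h
  · intro j
    refine Fin.cases ?_ (fun j => ?_) j
    · simpa using h
    · have := hR j
      simp only [Fin.cons_succ, consPerm_succ]
      rw [val_succAbove_eq]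
      split_ifs <;> omega

/-- A geometric weight spends at least a fraction `δ` of its mass on `[0, R) ∪ [R, R + h)`, when
the two intervals are counted with multiplicities `α` and `β`. -/
lemma sum_geom_damped_le {q α β δ : ℝ} {h : ℕ} (hq0 : 0 < q) (hq1 : q < 1) (hδ : 0 ≤ δ)
    (hα : δ ≤ α) (hβ : δ ≤ β * (1 - q ^ h)) (hβ0 : 0 ≤ β) (R k : ℕ) :
    ∑ r ∈ range k, q ^ r * (if r < R then 1 - α else if r < R + h then 1 - β else 1) ≤
      (1 - δ) * ∑ r ∈ range k, q ^ r := by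
  have hβδ : δ ≤ β := by
    have : 0 < q ^ h := by positivity
    nlinarith
  rcases le_or_gt k (R + h) with hk | hk
  · rw [mul_sum]
    refine sum_le_sum fun r hr => ?_
    have := mem_range.1 hr
    rw [mul_comm]
    gcongr
    split_ifs <;> grind
  · have key : ∑ r ∈ range k, q ^ r * (if r < R then 1 - α else if r < R + h then 1 - β else 1) =
        (∑ r ∈ range k, q ^ r) - α * (∑ r ∈ range R, q ^ r) -
          β * (q ^ R * ∑ r ∈ range h, q ^ r) := by
      obtain ⟨l, rfl⟩ := Nat.exists_eq_add_of_le hk.le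
      rw [sum_range_add, sum_range_add, sum_range_add, sum_range_add]
      have e1 : ∀ r ∈ range R, q ^ r * (if r < R then 1 - α else if r < R + h then 1 - β else 1) =
          q ^ r * (1 - α) := by
        intro r hr
        rw [if_pos (mem_range.1 hr)]
      have e2 : ∀ r ∈ range h, q ^ (R + r) * (if R + r < R then 1 - α else
          if R + r < R + h then 1 - β else 1) = q ^ R * (q ^ r * (1 - β)) := by
        intro r hr
        have := mem_range.1 hr
        rw [if_neg (by omega), if_pos (by omega), pow_add, mul_assoc]
      have e3 : ∀ r ∈ range l, q ^ (R + h + r) * (if R + h + r < R then 1 - α else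
          if R + h + r < R + h then 1 - β else 1) = q ^ (R + h + r) := by
        intro r hr
        rw [if_neg (by omega), if_neg (by omega), mul_one]
      have e4 : ∀ r ∈ range h, q ^ (R + r) = q ^ R * q ^ r := fun r _ => pow_add q R r
      rw [sum_congr rfl e1, sum_congr rfl e2, sum_congr rfl e3, sum_congr rfl e4, ← mul_sum,
        ← mul_sum, ← sum_mul, ← sum_mul]
      ring
    rw [key]
    have hg : ∀ j, ∑ r ∈ range j, q ^ r = (1 - q ^ j) / (1 - q) := fun j => by
      rw [geom_sum_eq hq1.ne, ← neg_sub 1 q, ← neg_sub 1 (q ^ j), neg_div_neg_eq]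
    have h1 : 0 < 1 - q := by linarith
    rw [hg, hg, hg]
    have hR0 : 0 < q ^ R := by positivity
    have hR1 : q ^ R ≤ 1 := pow_le_one₀ hq0.le hq1.le
    have hk0 : 0 < q ^ k := by positivity
    have main : δ * (1 - q ^ k) ≤ α * (1 - q ^ R) + β * (q ^ R * (1 - q ^ h)) := by
      nlinarith [mul_nonneg (sub_nonneg.2 hα) (sub_nonneg.2 hR1),
        mul_nonneg (sub_nonneg.2 hβ) hR0.le, mul_nonneg hδ hk0.le]
    have := div_le_div_of_nonneg_right main h1.le
    have e : (α * (1 - q ^ R) + β * (q ^ R * (1 - q ^ h))) / (1 - q) =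
      α * ((1 - q ^ R) / (1 - q)) + β * (q ^ R * ((1 - q ^ h) / (1 - q))) := by ring
    have e' : δ * (1 - q ^ k) / (1 - q) = δ * ((1 - q ^ k) / (1 - q)) := by ring
    rw [e, e'] at this
    linarith

lemma sum_pow_mallowsInv_succ (q : ℝ) (m : ℕ) :
    ∑ π : Equiv.Perm (Fin (m + 1)), q ^ mallowsInv π =
      (∑ r ∈ range (m + 1), q ^ r) * ∑ σ : Equiv.Perm (Fin m), q ^ mallowsInv σ := by
  rw [sum_perm_succ, ← Fin.sum_univ_eq_sum_range (fun r => q ^ r), sum_mul]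
  simp_rw [mallowsInv_consPerm, pow_add, mul_sum]

lemma sum_mallows_exp_lisAbove_le {q μ δ : ℝ} {h : ℕ} (hq0 : 0 < q) (hq1 : q < 1) (hδ : 0 ≤ δ)
    (hμ0 : 0 ≤ μ) (hμ : δ ≤ 1 - Real.exp (-μ))
    (hβ : δ ≤ (1 - Real.exp (-(μ * h))) * (1 - q ^ h)) (m R : ℕ) :
    ∑ π : Equiv.Perm (Fin m), q ^ mallowsInv π * Real.exp (-(2 * μ * h) * lisAbove π R) ≤
      (∑ π : Equiv.Perm (Fin m), q ^ mallowsInv π) * Real.exp (μ * R - δ * m) := by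
  induction m generalizing R with
  | zero =>
    rw [sum_mul]
    refine sum_le_sum fun π _ => ?_
    gcongr
    have : 0 ≤ 2 * μ * h * lisAbove π R := by positivity
    have : 0 ≤ μ * R := by positivity
    push_cast
    linarith
  | succ m ih =>
    set Z := ∑ σ : Equiv.Perm (Fin m), q ^ mallowsInv σ with hZ
    have hZ0 : 0 ≤ Z := sum_nonneg fun _ _ => by positivity
    have hμh : 0 ≤ μ * h := by positivity
    have step : ∀ r : Fin (m + 1),
        ∑ σ : Equiv.Perm (Fin m), q ^ mallowsInv (consPerm r σ) *
            Real.exp (-(2 * μ * h) * lisAbove (consPerm r σ) R) ≤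
          Z * Real.exp (μ * R - δ * m) * (q ^ (r : ℕ) * (if (r : ℕ) < R then
            1 - (1 - Real.exp (-μ)) else if (r : ℕ) < R + h then
              1 - (1 - Real.exp (-(μ * h))) else 1)) := by
      intro r
      have reduce : ∀ (R' : ℕ) (a b : ℝ),
          (∀ σ : Equiv.Perm (Fin m), -(2 * μ * h) * (lisAbove (consPerm r σ) R : ℝ) ≤
            a + -(2 * μ * h) * lisAbove σ R') → a + μ * R' ≤ μ * R + b →
          ∑ σ : Equiv.Perm (Fin m), q ^ mallowsInv (consPerm r σ) *
            Real.exp (-(2 * μ * h) * lisAbove (consPerm r σ) R) ≤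
          Z * Real.exp (μ * R - δ * m) * (q ^ (r : ℕ) * Real.exp b) := by
        intro R' a b hσ hab
        calc _ ≤ ∑ σ : Equiv.Perm (Fin m), q ^ (r : ℕ) * Real.exp a *
              (q ^ mallowsInv σ * Real.exp (-(2 * μ * h) * lisAbove σ R')) := by
              refine sum_le_sum fun σ _ => ?_
              rw [mallowsInv_consPerm, pow_add]
              have := Real.exp_le_exp.2 (hσ σ)
              rw [Real.exp_add] at this
              calc _ ≤ q ^ (r : ℕ) * q ^ mallowsInv σ *
                    (Real.exp a * Real.exp (-(2 * μ * h) * lisAbove σ R')) := by gcongr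
                _ = _ := by ring
          _ ≤ q ^ (r : ℕ) * Real.exp a * (Z * Real.exp (μ * R' - δ * m)) := by
              rw [← mul_sum]
              exact mul_le_mul_of_nonneg_left (ih R') (by positivity)
          _ = Z * q ^ (r : ℕ) * Real.exp (a + (μ * R' - δ * m)) := by
              rw [Real.exp_add]; ring
          _ ≤ Z * q ^ (r : ℕ) * Real.exp ((μ * R - δ * m) + b) := by
              refine mul_le_mul_of_nonneg_left (Real.exp_le_exp.2 ?_) (by positivity)
              linarith
          _ = _ := by
              rw [Real.exp_add]; ring
      split_ifs with h1 h2
      · rw [sub_sub_cancel]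
        refine reduce (R - 1) 0 (-μ) (fun σ => ?_) ?_
        · have : (lisAbove σ (R - 1) : ℝ) ≤ lisAbove (consPerm r σ) R := by
            exact_mod_cast lisAbove_pred_le_consPerm r σ h1
          nlinarith
        · rw [Nat.cast_sub (by omega)]
          push_cast
          linarith
      · rw [sub_sub_cancel]
        refine reduce r (-(2 * μ * h)) (-(μ * h)) (fun σ => ?_) ?_
        · have : (lisAbove σ r : ℝ) + 1 ≤ lisAbove (consPerm r σ) R := by
            exact_mod_cast lisAbove_add_one_le_consPerm r σ (not_lt.1 h1)
          nlinarith
        · have : (r : ℝ) ≤ R + h := by exact_mod_cast h2.le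
          nlinarith
      · rw [← Real.exp_zero]
        refine reduce R 0 0 (fun σ => ?_) (by simp)
        have : (lisAbove σ R : ℝ) ≤ lisAbove (consPerm r σ) R := by
          exact_mod_cast lisAbove_le_consPerm r σ
        nlinarith
    have hβ0 : 0 ≤ 1 - Real.exp (-(μ * h)) := by
      have := Real.exp_le_one_iff.2 (neg_nonpos.2 hμh)
      linarith
    have hgeom := sum_geom_damped_le hq0 hq1 hδ hμ hβ hβ0 R (m + 1)
    rw [sum_perm_succ, sum_pow_mallowsInv_succ]
    calc _ ≤ Z * Real.exp (μ * R - δ * m) * ∑ r ∈ range (m + 1), (q ^ r * (if r < R then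
            1 - (1 - Real.exp (-μ)) else if r < R + h then
              1 - (1 - Real.exp (-(μ * h))) else 1)) := by
          rw [← Fin.sum_univ_eq_sum_range (fun r => q ^ r * (if r < R then
            1 - (1 - Real.exp (-μ)) else if r < R + h then
              1 - (1 - Real.exp (-(μ * h))) else 1)), mul_sum]
          exact sum_le_sum fun r _ => step r
      _ ≤ Z * Real.exp (μ * R - δ * m) * (Real.exp (-δ) * ∑ r ∈ range (m + 1), q ^ r) := by
          gcongr
          refine hgeom.trans ?_
          gcongr
          have := Real.add_one_le_exp (-δ)
          linarith
      _ = _ := by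
          have : μ * R - δ * (m + 1 : ℕ) = (μ * R - δ * m) + -δ := by push_cast; ring
          rw [this, Real.exp_add]
          ring

/-- Chernoff bound for the lower tail of the longest increasing subsequence. -/
lemma mallowsProb_LIS_lt_le {q μ δ : ℝ} {h : ℕ} (hq0 : 0 < q) (hq1 : q < 1) (hδ : 0 ≤ δ)
    (hμ0 : 0 ≤ μ) (hμ : δ ≤ 1 - Real.exp (-μ))
    (hβ : δ ≤ (1 - Real.exp (-(μ * h))) * (1 - q ^ h)) (n L : ℕ) :
    mallowsProb n q {π | LIS π < L} ≤ Real.exp (2 * μ * h * L - δ * n) := by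
  have hZ : 0 < ∑ σ : Equiv.Perm (Fin n), q ^ mallowsInv σ :=
    sum_pos (fun _ _ => by positivity) univ_nonempty
  have hmain := sum_mallows_exp_lisAbove_le hq0 hq1 hδ hμ0 hμ hβ n 0
  set Z := ∑ σ : Equiv.Perm (Fin n), q ^ mallowsInv σ
  calc mallowsProb n q {π | LIS π < L}
      ≤ ∑ π : Equiv.Perm (Fin n), Real.exp (2 * μ * h * L) / Z *
          (q ^ mallowsInv π * Real.exp (-(2 * μ * h) * lisAbove π 0)) := by
        refine sum_le_sum fun π _ => ?_
        refine Set.indicator_le' (f := mallowsPMF n q) (g := fun π =>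
          Real.exp (2 * μ * h * L) / Z *
          (q ^ mallowsInv π * Real.exp (-(2 * μ * h) * lisAbove π 0))) ?_ ?_ π
        · intro π hπ
          have hL : (lisAbove π 0 : ℝ) ≤ L := by
            rw [lisAbove_zero]
            exact_mod_cast (show LIS π < L from hπ).le
          have h1 : 1 ≤ Real.exp (2 * μ * h * L + -(2 * μ * h) * lisAbove π 0) := by
            rw [Real.one_le_exp_iff]
            have : 0 ≤ μ * h := by positivity
            nlinarith
          calc mallowsPMF n q π = q ^ mallowsInv π / Z * 1 := by rw [mul_one, mallowsPMF]
            _ ≤ q ^ mallowsInv π / Z *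
                Real.exp (2 * μ * h * L + -(2 * μ * h) * lisAbove π 0) := by gcongr
            _ = _ := by rw [Real.exp_add]; ring
        · intro π _
          positivity
    _ ≤ Real.exp (2 * μ * h * L) / Z * (Z * Real.exp (μ * (0 : ℕ) - δ * n)) := by
        rw [← mul_sum]
        gcongr
    _ = Real.exp (2 * μ * h * L - δ * n) := by
        rw [Nat.cast_zero, mul_zero, zero_sub, sub_eq_add_neg (2 * μ * h * L), Real.exp_add]
        field_simp

lemma half_le_one_sub_exp_neg {x : ℝ} (hx0 : 0 ≤ x) (hx1 : x ≤ 1) :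
    x / 2 ≤ 1 - Real.exp (-x) := by
  have h : Real.exp (-x) ≤ 1 / (1 + x) := by
    rw [Real.exp_neg, ← one_div]
    exact one_div_le_one_div_of_le (by linarith) (by linarith [Real.add_one_le_exp x])
  have h2 : 1 / (1 + x) ≤ 1 - x / 2 := by
    rw [div_le_iff₀ (by linarith)]
    nlinarith
  linarith

/-- There is an absolute constant `c>0` so that for `n≥1`, `1/2 ≤ q ≤ 1 − 4/n`
and integer `n(1−q) ≤ L ≤ c·n·√(1−q)`, if `π ~ μ_{n,q}` then
`P(LIS(π) < L) ≤ exp(−c(1−q)n²/L)`. -/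
theorem mallows_LIS_lower_tail :
    ∃ c : ℝ, 0 < c ∧
      ∀ (n : ℕ) (q : ℝ) (L : ℕ), 1 ≤ n → 1 / 2 ≤ q → q ≤ 1 - 4 / (n : ℝ) →
        (n : ℝ) * (1 - q) ≤ (L : ℝ) → (L : ℝ) ≤ c * (n : ℝ) * Real.sqrt (1 - q) →
        mallowsProb n q {π | LIS π < L} ≤ Real.exp (-(c * (1 - q) * (n : ℝ) ^ 2 / (L : ℝ))) := by
  refine ⟨1 / 128, by norm_num, ?_⟩
  intro n q L hn hq hqn hL1 hL2
  have hn0 : (0 : ℝ) < n := by exact_mod_cast hn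
  obtain ⟨ε, rfl⟩ : ∃ ε, q = 1 - ε := ⟨1 - q, by ring⟩
  rw [sub_sub_cancel] at hL1 hL2 ⊢
  have hε : 0 < ε := by
    have : 0 < 4 / (n : ℝ) := by positivity
    linarith
  have hL0 : (0 : ℝ) < L := lt_of_lt_of_le (by positivity) hL1
  have hs1 : Real.sqrt ε ≤ 1 := Real.sqrt_le_one.2 (by linarith)
  have hs2 : Real.sqrt ε ^ 2 = ε := Real.sq_sqrt hε.le
  have hs0 : 0 < Real.sqrt ε := Real.sqrt_pos.2 hε
  -- The window of admissible jumps has length `h`, of order `n / L`.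
  obtain ⟨h, hh⟩ : ∃ h : ℕ, h = ⌊(n : ℝ) / (8 * L)⌋₊ := ⟨_, rfl⟩
  have hup : (h : ℝ) ≤ n / (8 * L) := hh ▸ Nat.floor_le (by positivity)
  have hlo : (n : ℝ) / (8 * L) < h + 1 := hh ▸ Nat.lt_floor_add_one _
  have hx2 : 2 ≤ (n : ℝ) / (8 * L) := by
    rw [le_div_iff₀ (by positivity)]
    nlinarith
  have hlo' : (n : ℝ) / (16 * L) ≤ h := by
    have : (n : ℝ) / (16 * L) = n / (8 * L) / 2 := by
      rw [div_div]; ring_nf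
    linarith
  have hh0 : (0 : ℝ) < h := lt_of_lt_of_le (by positivity) hlo'
  have hupL : (h : ℝ) * (8 * L) ≤ n := (le_div_iff₀ (by positivity)).1 hup
  have hloL : (n : ℝ) ≤ h * (16 * L) := (div_le_iff₀ (by positivity)).1 hlo'
  have hhε : h * ε ≤ 1 := by
    have h1 : h * ε * (8 * L) ≤ 1 * (8 * L) := by nlinarith
    exact le_of_mul_le_mul_right h1 (by positivity)
  have hhs : 8 ≤ h * Real.sqrt ε := by
    have h1 : 8 * L ≤ h * Real.sqrt ε * L := by nlinarith
    exact le_of_mul_le_mul_right h1 hL0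
  have hh2 : 1 ≤ h * ε / 2 * h := by
    have : h * ε / 2 * h = (h * Real.sqrt ε) ^ 2 / 2 := by
      rw [mul_pow, hs2]; ring
    rw [this]
    nlinarith
  have hpow : h * ε / 2 ≤ 1 - (1 - ε) ^ h := by
    have h1 : (1 - ε) ^ h ≤ Real.exp (-(h * ε)) := by
      have : Real.exp (-(h * ε)) = Real.exp (-ε) ^ h := by
        rw [← Real.exp_nat_mul]; ring_nf
      rw [this]
      exact pow_le_pow_left₀ (by linarith) (by linarith [Real.add_one_le_exp (-ε)]) h
    linarith [half_le_one_sub_exp_neg (by positivity) hhε]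
  have hβ : 1 / 2 ≤ 1 - Real.exp (-(h * ε / 2 * h)) := by
    have h1 : Real.exp (-(h * ε / 2 * h)) ≤ Real.exp (-1) :=
      Real.exp_le_exp.2 (neg_le_neg hh2)
    linarith [half_le_one_sub_exp_neg zero_le_one le_rfl]
  refine (mallowsProb_LIS_lt_le (μ := h * ε / 2) (δ := h * ε / 4) (h := h) (by linarith)
    (by linarith) (by positivity) (by positivity) ?_ ?_ n L).trans ?_
  · linarith [half_le_one_sub_exp_neg (x := h * ε / 2) (by positivity) (by linarith)]
  · have : 0 ≤ h * ε / 2 := by positivity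
    nlinarith [mul_le_mul hβ hpow this (by linarith)]
  · rw [Real.exp_le_exp]
    have h1 : 2 * (h * ε / 2) * h * L ≤ h * ε * n / 8 := by
      nlinarith [mul_le_mul_of_nonneg_left hupL (by positivity : 0 ≤ h * ε)]
    have h2 : 1 / 128 * ε * (n : ℝ) ^ 2 / L ≤ h * ε * n / 8 := by
      rw [div_le_iff₀ hL0]
      nlinarith [mul_le_mul_of_nonneg_left hloL (by positivity : 0 ≤ ε * n)]
    linarith
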